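/- Let h : ℝ^d → ℝ be α-Hölder for some α ∈ (0,1], and let f_h(x) = −∫₀¹ (1/(2t)) E[ h̄(√t x + √(1−t) Z) ] dt with h̄ = h − E h(Z), Z ~ N(0, I_d). Then for every β ∈ (0, α) the Hessian of f_h is globally β-Hölder in operator norm: for all x, y ∈ ℝ^d, ‖∇²f_h(x) − ∇²f_h(y)‖_op ≤ (C₁(α,d) + 2/(α−β)) |x−y|^β [h]_α, where C₁(α,d) = 2^{α/2+1} ((α+2d)/(αd)) Γ((α+d)/2)/Γ(d/2). -/

import Mathlib

open MeasureTheory ProbabilityTheory Real Filter Set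

noncomputable section

/-- The standard Gaussian measure `N(0, I_d)` on `ℝ^d` (as `EuclideanSpace ℝ (Fin d)`). -/
def stdGaussian (d : ℕ) : Measure (EuclideanSpace ℝ (Fin d)) :=
  (Measure.pi fun _ : Fin d => gaussianReal 0 1).map
    ⇑(EuclideanSpace.equiv (Fin d) ℝ).symm

/-- Partial derivative in the `j`-th coordinate direction. -/
def pderivI {d : ℕ} (j : Fin d) (f : EuclideanSpace ℝ (Fin d) → ℝ) :
    EuclideanSpace ℝ (Fin d) → ℝ :=
  fun x => fderiv ℝ f x (EuclideanSpace.single j 1)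

/-- Iterated partial derivative along a list of coordinate directions (head applied last,
i.e. outermost). -/
def pderivList {d : ℕ} : List (Fin d) → (EuclideanSpace ℝ (Fin d) → ℝ) →
    EuclideanSpace ℝ (Fin d) → ℝ
  | [], f => f
  | j :: l, f => pderivI j (pderivList l f)

/-- Multi-index partial derivative `∂^{|m|}/(∂x₁^{m₁} ⋯ ∂x_d^{m_d})`. -/
def pderivMulti {d : ℕ} (m : Fin d → ℕ) (f : EuclideanSpace ℝ (Fin d) → ℝ) :
    EuclideanSpace ℝ (Fin d) → ℝ :=
  pderivList ((List.finRange d).flatMap fun j => List.replicate (m j) j) f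

/-- Multivariate Hermite polynomial
`H_m(x) = (-1)^{|m|} e^{|x|²/2} ∂^{|m|}/(∂x₁^{m₁} ⋯ ∂x_d^{m_d}) e^{-|x|²/2}`. -/
def hermiteMulti {d : ℕ} (m : Fin d → ℕ) (x : EuclideanSpace ℝ (Fin d)) : ℝ :=
  (-1 : ℝ) ^ (∑ j, m j) * Real.exp (‖x‖ ^ 2 / 2) *
    pderivMulti m (fun y => Real.exp (-‖y‖ ^ 2 / 2)) x

/-- `h̄ = h - E h(Z)` with `Z ~ N(0, I_d)`. -/
def hbar (d : ℕ) (h : EuclideanSpace ℝ (Fin d) → ℝ) (x : EuclideanSpace ℝ (Fin d)) : ℝ :=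
  h x - ∫ z, h z ∂(stdGaussian d)

/-- Barbour's solution `f_h(x) = -∫₀¹ (1/(2t)) E[ h̄(√t x + √(1-t) Z) ] dt` of the
multivariate Stein equation. -/
def steinSol (d : ℕ) (h : EuclideanSpace ℝ (Fin d) → ℝ) (x : EuclideanSpace ℝ (Fin d)) : ℝ :=
  -∫ t in Ioo (0 : ℝ) 1,
      (1 / (2 * t)) *
        ∫ z, hbar d h (Real.sqrt t • x + Real.sqrt (1 - t) • z) ∂(stdGaussian d)

/-- Entry `(i, j)` of the Hessian matrix of `f` at `x`. -/
def hessEntry {d : ℕ} (f : EuclideanSpace ℝ (Fin d) → ℝ) (x : EuclideanSpace ℝ (Fin d))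
    (i j : Fin d) : ℝ :=
  pderivI i (pderivI j f) x

/-- The Hessian matrix `∇² f(x)`. -/
def hessMatrix {d : ℕ} (f : EuclideanSpace ℝ (Fin d) → ℝ) (x : EuclideanSpace ℝ (Fin d)) :
    Matrix (Fin d) (Fin d) ℝ :=
  Matrix.of fun i j => hessEntry f x i j

/-- Operator norm `‖M‖_op = sup_{|v| = 1} |M v|` (Euclidean norms) of a `d × d` matrix. -/
def matOpNorm {d : ℕ} (M : Matrix (Fin d) (Fin d) ℝ) : ℝ :=
  sSup { r | ∃ v : EuclideanSpace ℝ (Fin d), ‖v‖ = 1 ∧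
    r = ‖(WithLp.equiv 2 (Fin d → ℝ)).symm (M.mulVec ((WithLp.equiv 2 (Fin d → ℝ)) v))‖ }

/-- The Laplacian `Δ f(x) = ∑ i ∂²f/∂x_i²(x)`. -/
def laplacian {d : ℕ} (f : EuclideanSpace ℝ (Fin d) → ℝ) (x : EuclideanSpace ℝ (Fin d)) : ℝ :=
  ∑ i, hessEntry f x i i

/-- `C` is an `α`-Hölder constant for `h`. -/
def HolderConst {d : ℕ} (α C : ℝ) (h : EuclideanSpace ℝ (Fin d) → ℝ) : Prop :=
  ∀ x y, |h x - h y| ≤ C * dist x y ^ α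

/-- The 1-Wasserstein distance in dual form: sup over 1-Lipschitz test functions. -/
def wasserstein1 {d : ℕ} (μ ν : Measure (EuclideanSpace ℝ (Fin d))) : ℝ :=
  sSup { r | ∃ h : EuclideanSpace ℝ (Fin d) → ℝ, LipschitzWith 1 h ∧
    r = (∫ x, h x ∂μ) - ∫ x, h x ∂ν }

/-- The `α`-Wasserstein distance: sup over continuous `h` with `[h]_α ≤ 1`. -/
def wassersteinHolder {d : ℕ} (α : ℝ) (μ ν : Measure (EuclideanSpace ℝ (Fin d))) : ℝ :=
  sSup { r | ∃ h : EuclideanSpace ℝ (Fin d) → ℝ, Continuous h ∧ HolderConst α 1 h ∧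
    r = (∫ x, h x ∂μ) - ∫ x, h x ∂ν }

/-- The constant `C₁(α, d)`. -/
def C1 (α : ℝ) (d : ℕ) : ℝ :=
  2 ^ (α / 2 + 1) * ((α + 2 * d) / (α * d)) * Real.Gamma ((α + d) / 2) / Real.Gamma (d / 2)

/-- The constant `C₂(α, d)`. -/
def C2 (α : ℝ) (d : ℕ) : ℝ :=
  if α = 1 then 2 * Real.sqrt (2 / π) * Real.sqrt d
  else 2 ^ (α / 2 + 1) * (α + 2 * d) * Real.Gamma ((α + d) / 2) / (α * Real.Gamma (d / 2))

end

section GaussianMeasure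

variable {E : Type*} [NormedAddCommGroup E] [InnerProductSpace ℝ E]

/-- The density of the standard Gaussian measure with respect to Lebesgue measure. -/
noncomputable def gaussDensity (E : Type*) [NormedAddCommGroup E] [InnerProductSpace ℝ E]
    (z : E) : ℝ :=
  (2 * π) ^ (-(Module.finrank ℝ E / 2 : ℝ)) * rexp (-(1 / 2) * ‖z‖ ^ 2)

lemma gaussDensity_nonneg (z : E) : 0 ≤ gaussDensity E z := by
  unfold gaussDensity; positivity

lemma continuous_gaussDensity : Continuous (gaussDensity E) := by
  unfold gaussDensity; fun_prop

variable [FiniteDimensional ℝ E] [MeasurableSpace E] [BorelSpace E]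

lemma integrable_exp_neg_mul_sq_norm {b : ℝ} (hb : 0 < b) :
    Integrable (fun z : E => rexp (-b * ‖z‖ ^ 2)) := by
  have := (GaussianFourier.integrable_cexp_neg_mul_sq_norm_add (b := (b : ℂ)) (by simpa) 0
    (0 : E)).norm
  refine this.congr (ae_of_all _ fun z => ?_)
  simp only [Complex.norm_exp]
  congr 1
  simp [← Complex.ofReal_pow]

lemma integrable_gaussDensity : Integrable (gaussDensity E) :=
  (integrable_exp_neg_mul_sq_norm (by norm_num)).const_mul _

lemma integral_gaussDensity : ∫ z, gaussDensity E z = 1 := by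
  unfold gaussDensity
  rw [integral_const_mul, GaussianFourier.integral_rexp_neg_mul_sq_norm (by norm_num),
    show π / (1 / 2) = 2 * π by ring, ← Real.rpow_add (by positivity)]
  simp

lemma stdGaussian_eq_withDensity :
    ProbabilityTheory.stdGaussian E
      = volume.withDensity (fun z => ENNReal.ofReal (gaussDensity E z)) := by
  have : IsFiniteMeasure (volume.withDensity (fun z => ENNReal.ofReal (gaussDensity E z))) :=
    isFiniteMeasure_withDensity_ofReal integrable_gaussDensity.2
  apply Measure.ext_of_charFun
  ext t
  rw [charFun_stdGaussian, charFun_apply, integral_withDensity_eq_integral_toReal_smul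
    (by unfold gaussDensity; fun_prop) (ae_of_all _ fun _ => ENNReal.ofReal_lt_top)]
  have key := GaussianFourier.integral_cexp_neg_mul_sq_norm_add (V := E) (b := (1 / 2 : ℂ))
    (by norm_num) Complex.I t
  have hc : (((2 * π) ^ (-(Module.finrank ℝ E / 2 : ℝ)) : ℝ) : ℂ)
      * ((π : ℂ) / (1 / 2)) ^ (Module.finrank ℝ E / 2 : ℂ) = 1 := by
    rw [show (π : ℂ) / (1 / 2) = ((2 * π : ℝ) : ℂ) by push_cast; ring,
      show (Module.finrank ℝ E / 2 : ℂ) = ((Module.finrank ℝ E / 2 : ℝ) : ℂ) by push_cast; ring,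
      ← Complex.ofReal_cpow (by positivity), ← Complex.ofReal_mul,
      ← Real.rpow_add (by positivity)]
    simp
  have : ∀ z : E, (ENNReal.ofReal (gaussDensity E z)).toReal • Complex.exp (inner ℝ z t * Complex.I)
      = (((2 * π) ^ (-(Module.finrank ℝ E / 2 : ℝ)) : ℝ) : ℂ) *
        Complex.exp (-(1 / 2) * ‖z‖ ^ 2 + Complex.I * inner ℝ t z) := by
    intro z
    rw [ENNReal.toReal_ofReal (gaussDensity_nonneg z), gaussDensity, Complex.real_smul,
      Complex.exp_add, real_inner_comm]
    push_cast
    ring_nf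
  simp_rw [this]
  rw [integral_const_mul, key, ← mul_assoc, hc, one_mul]
  congr 1
  simp
  ring

lemma integral_stdGaussian_eq {F : Type*} [NormedAddCommGroup F] [NormedSpace ℝ F] (f : E → F) :
    ∫ z, f z ∂(ProbabilityTheory.stdGaussian E) = ∫ z, gaussDensity E z • f z := by
  rw [stdGaussian_eq_withDensity, integral_withDensity_eq_integral_toReal_smul
    (by unfold gaussDensity; fun_prop) (ae_of_all _ fun _ => ENNReal.ofReal_lt_top)]
  simp_rw [ENNReal.toReal_ofReal (gaussDensity_nonneg _)]

lemma integrable_norm_rpow_stdGaussian {p : ℝ} (hp : 0 ≤ p) :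
    Integrable (fun z : E => ‖z‖ ^ p) (ProbabilityTheory.stdGaussian E) := by
  rcases hp.eq_or_lt with rfl | hp
  · simp
  · have := (IsGaussian.memLp_id (ProbabilityTheory.stdGaussian E) (ENNReal.ofReal p)
      ENNReal.ofReal_ne_top).integrable_norm_rpow (by simpa using hp) ENNReal.ofReal_ne_top
    simpa [ENNReal.toReal_ofReal hp.le] using this

lemma integral_rpow_norm_mul_gauss [Nontrivial E] {p : ℝ} (hp : 0 ≤ p) :
    ∫ z : E, ‖z‖ ^ p * rexp (-(1 / 2) * ‖z‖ ^ 2)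
      = (Module.finrank ℝ E * (volume : Measure E).real (Metric.ball 0 1) *
          (1 / 2) ^ (-(Module.finrank ℝ E : ℝ) / 2) * (1 / 2)) *
          (2 ^ (p / 2) * Gamma ((p + Module.finrank ℝ E) / 2)) := by
  have hn : 0 < Module.finrank ℝ E := Module.finrank_pos
  have h1 : (1 : ℝ) ≤ Module.finrank ℝ E := by exact_mod_cast hn
  rw [integral_fun_norm_addHaar volume (fun r : ℝ => r ^ p * rexp (-(1 / 2) * r ^ 2))]
  have : ∫ y in Ioi (0 : ℝ), y ^ (Module.finrank ℝ E - 1) • (y ^ p * rexp (-(1 / 2) * y ^ 2))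
      = ∫ y in Ioi (0 : ℝ), y ^ (p + Module.finrank ℝ E - 1) * rexp (-(1 / 2) * y ^ (2 : ℝ)) := by
    refine setIntegral_congr_fun measurableSet_Ioi fun y hy => ?_
    simp only [smul_eq_mul]
    rw [← mul_assoc, ← Real.rpow_natCast, ← Real.rpow_add hy, Nat.cast_sub hn, Nat.cast_one,
      Real.rpow_two]
    ring_nf
  rw [this, integral_rpow_mul_exp_neg_mul_rpow (by norm_num) (by linarith) (by norm_num),
    show -(p + (Module.finrank ℝ E : ℝ) - 1 + 1) / 2 = -(Module.finrank ℝ E : ℝ) / 2 + -(p / 2) by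
      ring, Real.rpow_add (by norm_num) _ (-(p / 2)),
    show (1 / 2 : ℝ) ^ (-(p / 2)) = 2 ^ (p / 2) by
      rw [Real.rpow_neg (by norm_num), one_div, Real.inv_rpow (by norm_num), inv_inv]]
  simp only [nsmul_eq_mul, smul_eq_mul]
  ring_nf

lemma integral_norm_rpow_stdGaussian [Nontrivial E] {p : ℝ} (hp : 0 ≤ p) :
    ∫ z : E, ‖z‖ ^ p ∂(ProbabilityTheory.stdGaussian E)
      = 2 ^ (p / 2) * Gamma ((p + Module.finrank ℝ E) / 2) / Gamma (Module.finrank ℝ E / 2) := by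
  have hn : (0 : ℝ) < Module.finrank ℝ E := by exact_mod_cast Module.finrank_pos
  have hG : Gamma (Module.finrank ℝ E / 2 : ℝ) ≠ 0 := (Gamma_pos_of_pos (by positivity)).ne'
  have h0 := integral_gaussDensity (E := E)
  have e : ∀ q : ℝ, ∫ z : E, gaussDensity E z * ‖z‖ ^ q =
      (2 * π) ^ (-(Module.finrank ℝ E / 2 : ℝ)) *
        ∫ z : E, ‖z‖ ^ q * rexp (-(1 / 2) * ‖z‖ ^ 2) := by
    intro q
    rw [← integral_const_mul]
    congr 1; ext z; unfold gaussDensity; ring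
  have h1 := e 0
  simp only [Real.rpow_zero, mul_one] at h1
  rw [h0] at h1
  have h2 := integral_rpow_norm_mul_gauss (E := E) (le_refl 0)
  simp only [Real.rpow_zero, zero_div, zero_add] at h2
  rw [h2] at h1
  rw [integral_stdGaussian_eq]
  simp only [smul_eq_mul]
  rw [e, integral_rpow_norm_mul_gauss hp, eq_div_iff hG]
  linear_combination (2 ^ (p / 2) * Gamma ((p + Module.finrank ℝ E) / 2)) * (-h1)

lemma integrable_inner_sq_mul_norm_rpow_stdGaussian (v : E) {p : ℝ} (hp : 0 ≤ p) :
    Integrable (fun z : E => inner ℝ v z ^ 2 * ‖z‖ ^ p) (ProbabilityTheory.stdGaussian E) := by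
  refine ((integrable_norm_rpow_stdGaussian (E := E) (p := 2 + p) (by positivity)).const_mul
    (‖v‖ ^ 2)).mono' ?_ (ae_of_all _ fun z => ?_)
  · exact (Measurable.aestronglyMeasurable (by fun_prop))
  · rw [Real.rpow_add_of_nonneg (norm_nonneg _) (by norm_num) hp, Real.rpow_two,
      norm_of_nonneg (by positivity), ← mul_assoc, ← mul_pow]
    exact mul_le_mul_of_nonneg_right
      (sq_le_sq.mpr ((abs_real_inner_le_norm v z).trans (le_abs_self _))) (by positivity)

lemma integral_inner_sq_mul_norm_rpow_eq {v w : E} (h : ‖v‖ = ‖w‖) (p : ℝ) :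
    ∫ z : E, inner ℝ v z ^ 2 * ‖z‖ ^ p ∂(ProbabilityTheory.stdGaussian E) =
      ∫ z : E, inner ℝ w z ^ 2 * ‖z‖ ^ p ∂(ProbabilityTheory.stdGaussian E) := by
  set R := (ℝ ∙ (v - w))ᗮ.reflection with hR
  have hv : R v = w := Submodule.reflection_sub h
  conv_rhs => rw [← ProbabilityTheory.stdGaussian_map R]
  rw [integral_map (by fun_prop) (Measurable.aestronglyMeasurable (by fun_prop))]
  simp only [← hv, LinearIsometryEquiv.inner_map_map, LinearIsometryEquiv.norm_map]

lemma integral_inner_sq_mul_norm_rpow [Nontrivial E] {v : E} (hv : ‖v‖ = 1) {p : ℝ} (hp : 0 ≤ p) :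
    ∫ z : E, inner ℝ v z ^ 2 * ‖z‖ ^ p ∂(ProbabilityTheory.stdGaussian E) =
      (p + Module.finrank ℝ E) / Module.finrank ℝ E *
        ∫ z : E, ‖z‖ ^ p ∂(ProbabilityTheory.stdGaussian E) := by
  have hn : (0 : ℝ) < Module.finrank ℝ E := by exact_mod_cast Module.finrank_pos
  have hs : ∑ i, ∫ z : E, inner ℝ (stdOrthonormalBasis ℝ E i) z ^ 2 * ‖z‖ ^ p
      ∂(ProbabilityTheory.stdGaussian E) =
      ∫ z : E, ‖z‖ ^ (p + 2) ∂(ProbabilityTheory.stdGaussian E) := by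
    rw [← integral_finsetSum _ fun i _ =>
      integrable_inner_sq_mul_norm_rpow_stdGaussian _ hp]
    congr 1; ext z
    rw [← Finset.sum_mul, (stdOrthonormalBasis ℝ E).sum_sq_inner_right,
      Real.rpow_add_of_nonneg (norm_nonneg _) hp (by norm_num), Real.rpow_two, mul_comm]
  have hi : ∀ i, ∫ z : E, inner ℝ (stdOrthonormalBasis ℝ E i) z ^ 2 * ‖z‖ ^ p
      ∂(ProbabilityTheory.stdGaussian E) =
      ∫ z : E, inner ℝ v z ^ 2 * ‖z‖ ^ p ∂(ProbabilityTheory.stdGaussian E) := fun i =>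
    integral_inner_sq_mul_norm_rpow_eq (by simp [hv]) p
  simp only [hi, Finset.sum_const, Finset.card_univ, Fintype.card_fin, nsmul_eq_mul] at hs
  rw [integral_norm_rpow_stdGaussian (by positivity)] at hs
  rw [integral_norm_rpow_stdGaussian hp, eq_comm, div_mul_eq_mul_div, div_eq_iff hn.ne',
    mul_comm _ (Module.finrank ℝ E : ℝ), hs,
    show (p + 2 + (Module.finrank ℝ E : ℝ)) / 2 = (p + Module.finrank ℝ E) / 2 + 1 by ring,
    Gamma_add_one (by positivity), show (p + 2) / 2 = p / 2 + 1 by ring,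
    Real.rpow_add (by norm_num), Real.rpow_one]
  ring

lemma integral_inner_sq_stdGaussian (v : E) :
    ∫ z : E, inner ℝ v z ^ 2 ∂(ProbabilityTheory.stdGaussian E) = ‖v‖ ^ 2 := by
  have h := variance_dual_stdGaussian (innerSL ℝ v)
  rw [variance_of_integral_eq_zero (by fun_prop)
    (integral_strongDual_stdGaussian _)] at h
  simpa using h

end GaussianMeasure

section TranslationDerivative

variable {E : Type*} [NormedAddCommGroup E] [InnerProductSpace ℝ E] [FiniteDimensional ℝ E]
  [MeasurableSpace E] [BorelSpace E]

lemma half_sq_norm_sub_le {F : Type*} [SeminormedAddCommGroup F] (x y : F) :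
    ‖y‖ ^ 2 / 2 - ‖x‖ ^ 2 ≤ ‖y - x‖ ^ 2 := by
  have h : ‖y‖ ≤ ‖y - x‖ + ‖x‖ := norm_le_norm_sub_add y x
  nlinarith [sq_nonneg (‖y - x‖ - ‖x‖), norm_nonneg y, norm_nonneg x, norm_nonneg (y - x)]

lemma integrable_affine_mul_exp_neg (A B : ℝ) :
    Integrable (fun y : E => (A + B * ‖y‖) * rexp (-(1 / 8) * ‖y‖ ^ 2)) := by
  refine ((integrable_exp_neg_mul_sq_norm (E := E) (b := 1 / 16) (by norm_num)).const_mul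
    (|A| + 2 * |B|)).mono' (by fun_prop) (ae_of_all _ fun y => ?_)
  have h1 : 1 + 1 / 16 * ‖y‖ ^ 2 ≤ rexp (1 / 16 * ‖y‖ ^ 2) := by
    rw [add_comm]; exact Real.add_one_le_exp _
  have h2 : ‖y‖ ≤ 2 * rexp (1 / 16 * ‖y‖ ^ 2) := by nlinarith [sq_nonneg (‖y‖ / 4 - 1)]
  have h3 : 1 ≤ rexp (1 / 16 * ‖y‖ ^ 2) := by nlinarith [sq_nonneg ‖y‖]
  rw [norm_mul, norm_of_nonneg (Real.exp_pos _).le,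
    show -(1 / 16) * ‖y‖ ^ 2 = 1 / 16 * ‖y‖ ^ 2 + -(1 / 8) * ‖y‖ ^ 2 by ring, Real.exp_add,
    ← mul_assoc]
  gcongr
  calc ‖A + B * ‖y‖‖ ≤ |A| + |B| * ‖y‖ := by
        refine (norm_add_le _ _).trans_eq ?_
        rw [norm_mul, norm_norm, Real.norm_eq_abs, Real.norm_eq_abs]
    _ ≤ |A| * rexp (1 / 16 * ‖y‖ ^ 2) + |B| * (2 * rexp (1 / 16 * ‖y‖ ^ 2)) := by
        gcongr
        exact le_mul_of_one_le_right (abs_nonneg _) h3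
    _ = _ := by ring

/-- Differentiation of `x ↦ ∫ g y * q (y - x)` when `q` has Gaussian decay. -/
lemma hasFDerivAt_integral_mul_comp_sub {g q : E → ℝ} {q' : E → E →L[ℝ] ℝ} {A B K : ℝ}
    (hg : Continuous g) (hgb : ∀ y, |g y| ≤ A + B * ‖y‖)
    (hq : ∀ z, HasFDerivAt q (q' z) z) (hq' : Continuous q')
    (hqb : ∀ z, |q z| ≤ K * rexp (-(1 / 4) * ‖z‖ ^ 2))
    (hqb' : ∀ z, ‖q' z‖ ≤ K * rexp (-(1 / 4) * ‖z‖ ^ 2)) (x : E) :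
    HasFDerivAt (fun x => ∫ y, g y * q (y - x)) (-∫ y, g y • q' (y - x)) x := by
  have hqc : Continuous q := continuous_iff_continuousAt.2 fun z => (hq z).continuousAt
  have hK : 0 ≤ K := by
    have := (abs_nonneg _).trans (hqb 0)
    simpa using this
  have decay : ∀ x' ∈ Metric.ball x 1, ∀ y,
      rexp (-(1 / 4) * ‖y - x'‖ ^ 2) ≤
        rexp (1 / 4 * (‖x‖ + 1) ^ 2) * rexp (-(1 / 8) * ‖y‖ ^ 2) := by
    intro x' hx' y
    rw [← Real.exp_add]
    apply Real.exp_le_exp.2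
    have h1 : ‖x'‖ ≤ ‖x‖ + 1 := by
      have := norm_le_norm_sub_add x' x
      rw [mem_ball_iff_norm] at hx'
      linarith
    have h2 := half_sq_norm_sub_le x' y
    have h3 : ‖x'‖ ^ 2 ≤ (‖x‖ + 1) ^ 2 := by gcongr
    linarith
  have hint := (integrable_affine_mul_exp_neg (E := E) A B).const_mul
    (K * rexp (1 / 4 * (‖x‖ + 1) ^ 2))
  have dom : ∀ s c : ℝ, ∀ x' ∈ Metric.ball x 1, ∀ y, |s| ≤ A + B * ‖y‖ →
      c ≤ K * rexp (-(1 / 4) * ‖y - x'‖ ^ 2) → 0 ≤ c →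
      |s| * c ≤ K * rexp (1 / 4 * (‖x‖ + 1) ^ 2) *
        ((A + B * ‖y‖) * rexp (-(1 / 8) * ‖y‖ ^ 2)) := by
    intro s c x' hx' y hs hc hc0
    calc |s| * c ≤ (A + B * ‖y‖) * (K * (rexp (1 / 4 * (‖x‖ + 1) ^ 2) *
          rexp (-(1 / 8) * ‖y‖ ^ 2))) := by
          refine mul_le_mul hs (hc.trans ?_) hc0 ((abs_nonneg _).trans hs)
          gcongr
          exact decay x' hx' y
      _ = _ := by ring
  rw [← integral_neg]
  refine hasFDerivAt_integral_of_dominated_of_fderiv_le (F := fun x y => g y * q (y - x))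
    (F' := fun x y => -(g y • q' (y - x))) (Metric.ball_mem_nhds x one_pos)
    (Eventually.of_forall fun x' => Continuous.aestronglyMeasurable (by fun_prop)) ?_
    (Continuous.aestronglyMeasurable (by fun_prop))
    (ae_of_all _ fun y x' hx' => ?_) hint (ae_of_all _ fun y x' _ => ?_)
  · refine hint.mono' (Continuous.aestronglyMeasurable (by fun_prop)) (ae_of_all _ fun y => ?_)
    rw [norm_mul]
    exact dom _ _ x (Metric.mem_ball_self one_pos) y (hgb y) (hqb _) (abs_nonneg _)
  · rw [norm_neg, norm_smul]
    exact dom _ _ x' hx' y (hgb y) (hqb' _) (norm_nonneg _)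
  · have h1 : HasFDerivAt (fun x => y - x) (-ContinuousLinearMap.id ℝ E) x' := by
      simpa using (hasFDerivAt_id x').const_sub y
    have := ((hq (y - x')).comp x' h1).const_mul (g y)
    exact this.congr_fderiv (by ext v; simp)

/-- Differentiation of a Gaussian average `x ↦ E[p(Z) h(a x + b Z)]` by parts, where `φ r` is the
derivative of `φ p`, with `φ` the Gaussian density. -/
lemma hasFDerivAt_integral_stdGaussian_affine {h p : E → ℝ} {r : E → E →L[ℝ] ℝ} {A B K : ℝ}
    (hh : Continuous h) (hhb : ∀ y, |h y| ≤ A + B * ‖y‖)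
    (hp : ∀ z, HasFDerivAt (fun z => gaussDensity E z * p z) (gaussDensity E z • r z) z)
    (hr : Continuous r)
    (hpb : ∀ z, |gaussDensity E z * p z| ≤ K * rexp (-(1 / 4) * ‖z‖ ^ 2))
    (hrb : ∀ z, ‖gaussDensity E z • r z‖ ≤ K * rexp (-(1 / 4) * ‖z‖ ^ 2))
    (a : ℝ) {b : ℝ} (hb : 0 < b) (x : E) :
    HasFDerivAt (fun x => ∫ z, h (a • x + b • z) * p z ∂(ProbabilityTheory.stdGaussian E))
      (-(a / b) • ∫ z, h (a • x + b • z) • r z ∂(ProbabilityTheory.stdGaussian E)) x := by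
  have key := hasFDerivAt_integral_mul_comp_sub (g := fun y => h (b • y)) (A := A) (B := B * b)
    (by fun_prop) (fun y => by
      refine (hhb _).trans_eq ?_
      rw [norm_smul, norm_of_nonneg hb.le, mul_assoc]) hp
    (continuous_gaussDensity.smul hr) hpb hrb ((a / b) • x)
  have h1 : HasFDerivAt (fun x : E => (a / b) • x) ((a / b) • ContinuousLinearMap.id ℝ E) x :=
    (hasFDerivAt_id x).const_smul _
  have key2 := key.comp x h1
  have e : ∀ x z : E, b • (z + (a / b) • x) = a • x + b • z := by
    intro x z
    rw [smul_add, smul_smul, mul_div_cancel₀ _ hb.ne', add_comm]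
  have hfun : (fun x => ∫ z, h (a • x + b • z) * p z ∂(ProbabilityTheory.stdGaussian E)) =
      (fun x => ∫ y, h (b • y) * (gaussDensity E (y - x) * p (y - x))) ∘
        fun x => (a / b) • x := by
    ext x
    rw [integral_stdGaussian_eq, Function.comp_apply, ← integral_add_right_eq_self
      (fun y => h (b • y) * (gaussDensity E (y - (a / b) • x) * p (y - (a / b) • x)))
      ((a / b) • x)]
    simp only [add_sub_cancel_right, e, smul_eq_mul]
    congr 1; ext z; ring
  rw [hfun]
  refine key2.congr_fderiv ?_
  rw [integral_stdGaussian_eq, ← integral_add_right_eq_self _ ((a / b) • x)]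
  simp only [add_sub_cancel_right, e, smul_smul]
  ext v
  simp [mul_comm]

lemma hasFDerivAt_gaussDensity {E : Type*} [NormedAddCommGroup E] [InnerProductSpace ℝ E] (z : E) :
    HasFDerivAt (gaussDensity E) (gaussDensity E z • -innerSL ℝ z) z := by
  have h1 : HasFDerivAt (fun z : E => -(1 / 2) * ‖z‖ ^ 2) (-innerSL ℝ z) z :=
    ((hasStrictFDerivAt_norm_sq z).hasFDerivAt.const_mul (-(1 / 2) : ℝ)).congr_fderiv (by
      ext v; simp)
  exact (h1.exp.const_mul _).congr_fderiv (by rw [smul_smul]; rfl)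

lemma mul_gaussDensity_le {E : Type*} [NormedAddCommGroup E] [InnerProductSpace ℝ E]
    {c : ℝ} {z : E} (k : ℝ) (hk : 0 ≤ k) (hc : c ≤ k * (1 + ‖z‖ ^ 2)) :
    gaussDensity E z * c ≤
      (4 * k * (2 * π) ^ (-(Module.finrank ℝ E / 2 : ℝ))) * rexp (-(1 / 4) * ‖z‖ ^ 2) := by
  have h1 : 1 + ‖z‖ ^ 2 ≤ 4 * rexp (1 / 4 * ‖z‖ ^ 2) := by
    linarith [Real.add_one_le_exp (1 / 4 * ‖z‖ ^ 2)]
  have h2 : rexp (-(1 / 4) * ‖z‖ ^ 2) =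
      rexp (1 / 4 * ‖z‖ ^ 2) * rexp (-(1 / 2) * ‖z‖ ^ 2) := by
    rw [← Real.exp_add]; ring_nf
  calc gaussDensity E z * c ≤ gaussDensity E z * (k * (4 * rexp (1 / 4 * ‖z‖ ^ 2))) := by
        refine mul_le_mul_of_nonneg_left (hc.trans ?_) (gaussDensity_nonneg z)
        gcongr
    _ = _ := by rw [h2, gaussDensity]; ring

lemma hasFDerivAt_integral_stdGaussian {h : E → ℝ} {A B : ℝ}
    (hh : Continuous h) (hhb : ∀ y, |h y| ≤ A + B * ‖y‖) (a : ℝ) {b : ℝ} (hb : 0 < b) (x : E) :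
    HasFDerivAt (fun x => ∫ z, h (a • x + b • z) ∂(ProbabilityTheory.stdGaussian E))
      ((a / b) • ∫ z, h (a • x + b • z) • innerSL ℝ z ∂(ProbabilityTheory.stdGaussian E)) x := by
  have key := hasFDerivAt_integral_stdGaussian_affine (p := fun _ => 1)
    (r := fun z => -innerSL ℝ z) hh hhb (fun z => by simpa using hasFDerivAt_gaussDensity z)
    (by fun_prop)
    (fun z => by
      rw [mul_one, abs_of_nonneg (gaussDensity_nonneg z), ← mul_one (gaussDensity E z)]
      exact mul_gaussDensity_le 1 zero_le_one (by nlinarith [sq_nonneg ‖z‖]))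
    (fun z => by
      rw [norm_smul, norm_of_nonneg (gaussDensity_nonneg z), norm_neg, innerSL_apply_norm]
      exact mul_gaussDensity_le 1 zero_le_one (by nlinarith [sq_nonneg (‖z‖ - 1)])) a hb x
  simpa [integral_neg] using key

lemma norm_inner_smul_innerSL_sub_le {E : Type*} [NormedAddCommGroup E] [InnerProductSpace ℝ E]
    (u z : E) :
    ‖inner ℝ u z • innerSL ℝ z - innerSL ℝ u‖ ≤ ‖u‖ * (1 + ‖z‖ ^ 2) := by
  refine (norm_sub_le _ _).trans ?_
  rw [norm_smul, innerSL_apply_norm, innerSL_apply_norm]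
  have := norm_inner_le_norm (𝕜 := ℝ) u z
  nlinarith [norm_nonneg z]

lemma hasFDerivAt_integral_mul_inner_stdGaussian {h : E → ℝ} {A B : ℝ}
    (hh : Continuous h) (hhb : ∀ y, |h y| ≤ A + B * ‖y‖) (u : E) (a : ℝ) {b : ℝ} (hb : 0 < b)
    (x : E) :
    HasFDerivAt
      (fun x => ∫ z, h (a • x + b • z) * inner ℝ u z ∂(ProbabilityTheory.stdGaussian E))
      ((a / b) • ∫ z, h (a • x + b • z) • (inner ℝ u z • innerSL ℝ z - innerSL ℝ u)
        ∂(ProbabilityTheory.stdGaussian E)) x := by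
  have key := hasFDerivAt_integral_stdGaussian_affine (p := fun z => inner ℝ u z)
    (r := fun z => -(inner ℝ u z • innerSL ℝ z - innerSL ℝ u)) hh hhb
    (fun z => ((hasFDerivAt_gaussDensity z).mul (innerSL ℝ u).hasFDerivAt).congr_fderiv (by
      ext v; simp; ring))
    (by fun_prop)
    (fun z => by
      rw [abs_mul, abs_of_nonneg (gaussDensity_nonneg z)]
      refine mul_gaussDensity_le ‖u‖ (norm_nonneg u) ((abs_real_inner_le_norm u z).trans ?_)
      gcongr
      nlinarith [sq_nonneg (‖z‖ - 1)])
    (fun z => by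
      rw [norm_smul, norm_of_nonneg (gaussDensity_nonneg z), norm_neg]
      exact mul_gaussDensity_le ‖u‖ (norm_nonneg u) (norm_inner_smul_innerSL_sub_le u z))
    a hb x
  simpa only [smul_neg, integral_neg, neg_smul, neg_neg] using key

end TranslationDerivative

section HolderAverages

variable {E : Type*} [NormedAddCommGroup E]

lemma continuous_of_abs_sub_le_rpow {h : E → ℝ} {α C : ℝ} (hα : 0 < α)
    (hC : ∀ x y, |h x - h y| ≤ C * ‖x - y‖ ^ α) : Continuous h := by
  refine continuous_iff_continuousAt.2 fun x => ?_
  rw [ContinuousAt, tendsto_iff_norm_sub_tendsto_zero]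
  have : Tendsto (fun y => C * ‖y - x‖ ^ α) (nhds x) (nhds 0) := by
    have hc : Continuous fun y : E => C * ‖y - x‖ ^ α :=
      continuous_const.mul ((continuous_norm.comp (continuous_sub_right x)).rpow_const
        fun _ => Or.inr hα.le)
    simpa [Real.zero_rpow hα.ne'] using hc.tendsto x
  exact squeeze_zero (fun _ => norm_nonneg _) (fun y => hC y x) this

lemma rpow_le_one_add {t α : ℝ} (ht : 0 ≤ t) (hα0 : 0 ≤ α) (hα1 : α ≤ 1) : t ^ α ≤ 1 + t := by
  rcases le_total t 1 with h | h
  · linarith [Real.rpow_le_one ht h hα0]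
  · linarith [(Real.rpow_le_rpow_of_exponent_le h hα1).trans_eq (Real.rpow_one t)]

lemma abs_le_of_abs_sub_le_rpow {h : E → ℝ} {α C : ℝ} (hα : α ∈ Ioc (0 : ℝ) 1) (hC0 : 0 ≤ C)
    (hC : ∀ x y, |h x - h y| ≤ C * ‖x - y‖ ^ α) (y : E) :
    |h y| ≤ (|h 0| + C) + C * ‖y‖ := by
  have h1 := hC y 0
  rw [sub_zero] at h1
  have h2 := abs_sub_abs_le_abs_sub (h y) (h 0)
  have h3 := mul_le_mul_of_nonneg_left (rpow_le_one_add (norm_nonneg y) hα.1.le hα.2) hC0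
  linarith

variable [InnerProductSpace ℝ E] [FiniteDimensional ℝ E] [MeasurableSpace E] [BorelSpace E]

lemma integrable_stdGaussian_of_cubic_growth {F : Type*} [NormedAddCommGroup F] {f : E → F}
    (hf : Continuous f) {K : ℝ} (hK : ∀ z, ‖f z‖ ≤ K * (1 + ‖z‖) ^ 3) :
    Integrable f (ProbabilityTheory.stdGaussian E) := by
  have hK0 : 0 ≤ K := by simpa using (norm_nonneg _).trans (hK 0)
  refine (((integrable_const (1 : ℝ)).add (integrable_norm_rpow_stdGaussian (E := E)
    (p := 3) (by norm_num))).const_mul (4 * K)).mono' hf.aestronglyMeasurable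
    (ae_of_all _ fun z => (hK z).trans ?_)
  have h1 : ‖z‖ ^ (3 : ℝ) = ‖z‖ ^ 3 := by norm_cast
  simp only [Pi.add_apply, h1]
  have : (1 + ‖z‖) ^ 3 ≤ 4 * (1 + ‖z‖ ^ 3) := by
    nlinarith [mul_nonneg (add_nonneg zero_le_one (norm_nonneg z)) (sq_nonneg (‖z‖ - 1))]
  nlinarith

lemma integrable_stdGaussian_of_quadratic_growth {F : Type*} [NormedAddCommGroup F] {R : E → F}
    (hR : Continuous R) {K : ℝ} (hRb : ∀ z, ‖R z‖ ≤ K * (1 + ‖z‖ ^ 2)) :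
    Integrable R (ProbabilityTheory.stdGaussian E) := by
  have hK0 : 0 ≤ K := by simpa using (norm_nonneg _).trans (hRb 0)
  refine integrable_stdGaussian_of_cubic_growth hR fun z =>
    (hRb z).trans (mul_le_mul_of_nonneg_left ?_ hK0)
  nlinarith [norm_nonneg z, pow_nonneg (norm_nonneg z) 3, sq_nonneg ‖z‖]

lemma integrable_norm_rpow_mul_norm {F : Type*} [NormedAddCommGroup F] {α K : ℝ} {R : E → F}
    (hα : α ∈ Ioc (0 : ℝ) 1) (hR : Continuous R)
    (hRb : ∀ z, ‖R z‖ ≤ K * (1 + ‖z‖ ^ 2)) :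
    Integrable (fun z => ‖z‖ ^ α * ‖R z‖) (ProbabilityTheory.stdGaussian E) := by
  have hK0 : 0 ≤ K := by simpa using (norm_nonneg _).trans (hRb 0)
  refine integrable_stdGaussian_of_cubic_growth
    ((continuous_norm.rpow_const fun _ => Or.inr hα.1.le).mul hR.norm) (K := K) fun z => ?_
  rw [norm_of_nonneg (by positivity)]
  calc ‖z‖ ^ α * ‖R z‖ ≤ (1 + ‖z‖) * (K * (1 + ‖z‖) ^ 2) := by
        refine mul_le_mul (rpow_le_one_add (norm_nonneg z) hα.1.le hα.2) ((hRb z).trans ?_)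
          (norm_nonneg _) (by positivity)
        refine mul_le_mul_of_nonneg_left ?_ hK0
        nlinarith [norm_nonneg z]
    _ = _ := by ring

section Weighted

variable {F : Type*} [NormedAddCommGroup F] [NormedSpace ℝ F] {h : E → ℝ} {α C K : ℝ} {R : E → F}

lemma integrable_comp_affine_smul_stdGaussian (hα : α ∈ Ioc (0 : ℝ) 1) (hC0 : 0 ≤ C)
    (hC : ∀ x y, |h x - h y| ≤ C * ‖x - y‖ ^ α) (hR : Continuous R)
    (hRb : ∀ z, ‖R z‖ ≤ K * (1 + ‖z‖ ^ 2)) (a b : ℝ) (x : E) :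
    Integrable (fun z => h (a • x + b • z) • R z) (ProbabilityTheory.stdGaussian E) := by
  have hh := continuous_of_abs_sub_le_rpow hα.1 hC
  have hK0 : 0 ≤ K := by simpa using (norm_nonneg _).trans (hRb 0)
  refine integrable_stdGaussian_of_cubic_growth (by fun_prop)
    (K := (|h 0| + C + C * (|a| * ‖x‖) + C * |b|) * K) fun z => ?_
  rw [norm_smul, Real.norm_eq_abs]
  have h1 : |h (a • x + b • z)| ≤
      (|h 0| + C + C * (|a| * ‖x‖) + C * |b|) * (1 + ‖z‖) := by
    have h2 : ‖a • x + b • z‖ ≤ |a| * ‖x‖ + |b| * ‖z‖ := by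
      refine (norm_add_le _ _).trans_eq ?_
      rw [norm_smul, norm_smul, Real.norm_eq_abs, Real.norm_eq_abs]
    have h3 := abs_le_of_abs_sub_le_rpow hα hC0 hC (a • x + b • z)
    have h4 := mul_le_mul_of_nonneg_left h2 hC0
    have h5 : 0 ≤ (|h 0| + C + C * (|a| * ‖x‖)) * ‖z‖ := by positivity
    have h6 : 0 ≤ C * |b| := by positivity
    nlinarith
  calc |h (a • x + b • z)| * ‖R z‖
      ≤ ((|h 0| + C + C * (|a| * ‖x‖) + C * |b|) * (1 + ‖z‖)) * (K * (1 + ‖z‖) ^ 2) := by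
        refine mul_le_mul h1 ((hRb z).trans ?_) (norm_nonneg _) (by positivity)
        refine mul_le_mul_of_nonneg_left ?_ hK0
        nlinarith [norm_nonneg z]
    _ = _ := by ring

/-- A Gaussian average of a Hölder function against a centred weight gains `b ^ α`. -/
lemma norm_integral_comp_affine_smul_le (hα : α ∈ Ioc (0 : ℝ) 1) (hC0 : 0 ≤ C)
    (hC : ∀ x y, |h x - h y| ≤ C * ‖x - y‖ ^ α) (hR : Continuous R)
    (hRb : ∀ z, ‖R z‖ ≤ K * (1 + ‖z‖ ^ 2))
    (hR0 : ∫ z, R z ∂(ProbabilityTheory.stdGaussian E) = 0) (a : ℝ) {b : ℝ} (hb : 0 ≤ b) (x : E) :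
    ‖∫ z, h (a • x + b • z) • R z ∂(ProbabilityTheory.stdGaussian E)‖ ≤
      C * b ^ α * ∫ z, ‖z‖ ^ α * ‖R z‖ ∂(ProbabilityTheory.stdGaussian E) := by
  have h1 : ∫ z, h (a • x + b • z) • R z ∂(ProbabilityTheory.stdGaussian E) =
      ∫ z, (h (a • x + b • z) - h (a • x)) • R z ∂(ProbabilityTheory.stdGaussian E) := by
    have hi : Integrable (fun z => h (a • x) • R z) (ProbabilityTheory.stdGaussian E) :=
      (integrable_stdGaussian_of_quadratic_growth hR hRb).smul _
    simp_rw [sub_smul]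
    rw [integral_sub (integrable_comp_affine_smul_stdGaussian hα hC0 hC hR hRb a b x) hi,
      integral_smul, hR0,
      smul_zero, sub_zero]
  rw [h1, ← integral_const_mul]
  refine norm_integral_le_of_norm_le
    ((integrable_norm_rpow_mul_norm hα hR hRb).const_mul _) (ae_of_all _ fun z => ?_)
  rw [norm_smul, Real.norm_eq_abs, ← mul_assoc]
  gcongr
  refine (hC _ _).trans_eq ?_
  rw [add_sub_cancel_left, norm_smul, norm_of_nonneg hb, Real.mul_rpow hb (norm_nonneg z),
    mul_assoc]

lemma norm_integral_comp_affine_smul_sub_le (hα : α ∈ Ioc (0 : ℝ) 1) (hC0 : 0 ≤ C)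
    (hC : ∀ x y, |h x - h y| ≤ C * ‖x - y‖ ^ α) (hR : Continuous R)
    (hRb : ∀ z, ‖R z‖ ≤ K * (1 + ‖z‖ ^ 2)) {a : ℝ} (ha : 0 ≤ a) (b : ℝ) (x y : E) :
    ‖∫ z, h (a • x + b • z) • R z ∂(ProbabilityTheory.stdGaussian E) -
      ∫ z, h (a • y + b • z) • R z ∂(ProbabilityTheory.stdGaussian E)‖ ≤
      C * a ^ α * ‖x - y‖ ^ α * ∫ z, ‖R z‖ ∂(ProbabilityTheory.stdGaussian E) := by
  rw [← integral_sub (integrable_comp_affine_smul_stdGaussian hα hC0 hC hR hRb a b x)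
    (integrable_comp_affine_smul_stdGaussian hα hC0 hC hR hRb a b y), ← integral_const_mul]
  refine norm_integral_le_of_norm_le
    ((integrable_stdGaussian_of_quadratic_growth hR hRb).norm.const_mul _) (ae_of_all _ fun z => ?_)
  rw [← sub_smul, norm_smul, Real.norm_eq_abs]
  gcongr
  refine (hC _ _).trans_eq ?_
  rw [add_sub_add_right_eq_sub, ← smul_sub, norm_smul, norm_of_nonneg ha,
    Real.mul_rpow ha (norm_nonneg _), mul_assoc]

end Weighted

lemma integrable_comp_affine_stdGaussian {h : E → ℝ} {α C : ℝ} (hα : α ∈ Ioc (0 : ℝ) 1)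
    (hC0 : 0 ≤ C) (hC : ∀ x y, |h x - h y| ≤ C * ‖x - y‖ ^ α) (a b : ℝ) (x : E) :
    Integrable (fun z => h (a • x + b • z)) (ProbabilityTheory.stdGaussian E) := by
  simpa using integrable_comp_affine_smul_stdGaussian (R := fun _ => (1 : ℝ)) (K := 1) hα hC0 hC
    continuous_const (fun z => by simp) a b x

lemma integrable_of_abs_sub_le_rpow {h : E → ℝ} {α C : ℝ} (hα : α ∈ Ioc (0 : ℝ) 1)
    (hC0 : 0 ≤ C) (hC : ∀ x y, |h x - h y| ≤ C * ‖x - y‖ ^ α) :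
    Integrable h (ProbabilityTheory.stdGaussian E) := by
  simpa using integrable_comp_affine_stdGaussian hα hC0 hC 0 1 (0 : E)

lemma one_sub_sqrt_one_sub_le {t : ℝ} (ht : t ∈ Ioo (0 : ℝ) 1) : 1 - √(1 - t) ≤ √t := by
  nlinarith [Real.sq_sqrt ht.1.le, Real.sq_sqrt (sub_nonneg.2 ht.2.le), Real.sqrt_nonneg t,
    Real.sqrt_nonneg (1 - t)]

lemma abs_integral_comp_affine_sub_le {h : E → ℝ} {α C : ℝ} (hα : α ∈ Ioc (0 : ℝ) 1)
    (hC0 : 0 ≤ C) (hC : ∀ x y, |h x - h y| ≤ C * ‖x - y‖ ^ α) {t : ℝ} (ht : t ∈ Ioo (0 : ℝ) 1)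
    (x : E) :
    |∫ z, h (√t • x + √(1 - t) • z) ∂(ProbabilityTheory.stdGaussian E) -
      ∫ z, h z ∂(ProbabilityTheory.stdGaussian E)| ≤
      C * t ^ (α / 2) * ∫ z, (‖x‖ + ‖z‖) ^ α ∂(ProbabilityTheory.stdGaussian E) := by
  rw [← integral_sub (integrable_comp_affine_stdGaussian hα hC0 hC _ _ x)
    (integrable_of_abs_sub_le_rpow hα hC0 hC), ← integral_const_mul, ← Real.norm_eq_abs]
  have hint : Integrable (fun z : E => (‖x‖ + ‖z‖) ^ α) (ProbabilityTheory.stdGaussian E) := by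
    refine integrable_stdGaussian_of_cubic_growth ((continuous_const.add continuous_norm).rpow_const
      fun _ => Or.inr hα.1.le) (K := 1 + ‖x‖) fun z => ?_
    rw [norm_of_nonneg (by positivity)]
    refine (rpow_le_one_add (by positivity) hα.1.le hα.2).trans ?_
    have h1 : 1 + ‖z‖ ≤ (1 + ‖z‖) ^ 3 :=
      le_self_pow₀ (by linarith [norm_nonneg z]) (by norm_num)
    nlinarith [norm_nonneg x, norm_nonneg z, mul_nonneg (norm_nonneg x) (norm_nonneg z)]
  refine norm_integral_le_of_norm_le (hint.const_mul _) (ae_of_all _ fun z => ?_)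
  rw [Real.norm_eq_abs]
  refine (hC _ _).trans ?_
  rw [mul_assoc]
  gcongr
  have hs : t ^ (α / 2) = √t ^ α := by
    rw [Real.sqrt_eq_rpow, ← Real.rpow_mul ht.1.le]; ring_nf
  rw [hs, ← Real.mul_rpow (Real.sqrt_nonneg t) (by positivity)]
  refine Real.rpow_le_rpow (norm_nonneg _) ?_ hα.1.le
  have h1 : √t • x + √(1 - t) • z - z = √t • x + -((1 - √(1 - t)) • z) := by
    rw [sub_smul, one_smul]; abel
  have h2 : 0 ≤ 1 - √(1 - t) := by
    rw [sub_nonneg, Real.sqrt_le_one]; linarith [ht.1]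
  rw [h1, mul_add]
  refine (norm_add_le _ _).trans ?_
  rw [norm_neg, norm_smul, norm_smul, norm_of_nonneg (Real.sqrt_nonneg t), norm_of_nonneg h2]
  gcongr
  exact one_sub_sqrt_one_sub_le ht

lemma norm_innerSL_le_one_add_sq {E : Type*} [NormedAddCommGroup E] [InnerProductSpace ℝ E]
    (z : E) : ‖innerSL ℝ z‖ ≤ 1 * (1 + ‖z‖ ^ 2) := by
  rw [innerSL_apply_norm]
  nlinarith [sq_nonneg (‖z‖ - 1)]

lemma abs_inner_mul_inner_sub_le {E : Type*} [NormedAddCommGroup E] [InnerProductSpace ℝ E]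
    (u v z : E) :
    ‖inner ℝ u z * inner ℝ v z - inner ℝ u v‖ ≤ (‖u‖ * ‖v‖) * (1 + ‖z‖ ^ 2) := by
  have h := (inner ℝ u z • innerSL ℝ z - innerSL ℝ u).le_opNorm v
  have h2 := mul_le_mul_of_nonneg_right (norm_inner_smul_innerSL_sub_le u z) (norm_nonneg v)
  have e : (inner ℝ u z • innerSL ℝ z - innerSL ℝ u) v
      = inner ℝ u z * inner ℝ v z - inner ℝ u v := by
    simp [real_inner_comm]
  rw [e] at h
  linarith

lemma integral_innerSL_stdGaussian :
    ∫ z : E, innerSL ℝ z ∂(ProbabilityTheory.stdGaussian E) = 0 := by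
  have h := ContinuousLinearMap.integral_comp_comm (μ := ProbabilityTheory.stdGaussian E)
    (innerSL ℝ (E := E)) (φ := fun z => z) IsGaussian.integrable_id
  simpa [integral_id_stdGaussian] using h

lemma integral_inner_mul_inner_sub_stdGaussian (u v : E) :
    ∫ z : E, (inner ℝ u z * inner ℝ v z - inner ℝ u v) ∂(ProbabilityTheory.stdGaussian E) = 0 := by
  have e : ∀ z : E, inner ℝ u z * inner ℝ v z - inner ℝ u v =
      1 / 4 * (inner ℝ (u + v) z ^ 2 - inner ℝ (u - v) z ^ 2) - inner ℝ u v := by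
    intro z; rw [inner_add_left, inner_sub_left]; ring
  have hi : ∀ w : E, Integrable (fun z => inner ℝ w z ^ 2) (ProbabilityTheory.stdGaussian E) :=
    fun w => by simpa using integrable_inner_sq_mul_norm_rpow_stdGaussian w le_rfl
  have hi' : Integrable (fun z => 1 / 4 * (inner ℝ (u + v) z ^ 2 - inner ℝ (u - v) z ^ 2))
      (ProbabilityTheory.stdGaussian E) := ((hi _).sub (hi _)).const_mul _
  simp_rw [e]
  rw [integral_sub hi' (integrable_const _), integral_const_mul,
    integral_sub (hi _) (hi _), integral_inner_sq_stdGaussian, integral_inner_sq_stdGaussian,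
    @norm_add_sq_real, @norm_sub_sq_real]
  simp
  ring

lemma integral_inner_smul_innerSL_sub_stdGaussian (u : E) :
    ∫ z : E, (inner ℝ u z • innerSL ℝ z - innerSL ℝ u) ∂(ProbabilityTheory.stdGaussian E) = 0 := by
  ext v
  rw [ContinuousLinearMap.integral_apply (integrable_stdGaussian_of_quadratic_growth
    (by fun_prop) (norm_inner_smul_innerSL_sub_le u))]
  simpa [real_inner_comm] using integral_inner_mul_inner_sub_stdGaussian u v

lemma integral_norm_rpow_mul_abs_inner_mul_inner_sub_le [Nontrivial E] {u v : E} (hu : ‖u‖ = 1)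
    (hv : ‖v‖ = 1) {p : ℝ} (hp : 0 ≤ p) :
    ∫ z : E, ‖z‖ ^ p * |inner ℝ u z * inner ℝ v z - inner ℝ u v|
        ∂(ProbabilityTheory.stdGaussian E) ≤
      (2 + p / Module.finrank ℝ E) * ∫ z : E, ‖z‖ ^ p ∂(ProbabilityTheory.stdGaussian E) := by
  have hn : (0 : ℝ) < Module.finrank ℝ E := by exact_mod_cast Module.finrank_pos
  have hi := fun w : E => integrable_inner_sq_mul_norm_rpow_stdGaussian w hp
  have h0 := integrable_norm_rpow_stdGaussian (E := E) hp
  have hi' : Integrable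
      (fun z => 1 / 2 * (inner ℝ u z ^ 2 * ‖z‖ ^ p + inner ℝ v z ^ 2 * ‖z‖ ^ p))
      (ProbabilityTheory.stdGaussian E) := ((hi u).add (hi v)).const_mul _
  have key : ∫ z : E, (1 / 2 * (inner ℝ u z ^ 2 * ‖z‖ ^ p + inner ℝ v z ^ 2 * ‖z‖ ^ p) + ‖z‖ ^ p)
      ∂(ProbabilityTheory.stdGaussian E) =
      (2 + p / Module.finrank ℝ E) * ∫ z : E, ‖z‖ ^ p ∂(ProbabilityTheory.stdGaussian E) := by
    rw [integral_add hi' h0, integral_const_mul,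
      integral_add (hi u) (hi v), integral_inner_sq_mul_norm_rpow hu hp,
      integral_inner_sq_mul_norm_rpow hv hp]
    field_simp
    ring
  rw [← key]
  refine integral_mono_of_nonneg (ae_of_all _ fun z => by positivity)
    (hi'.add h0) (ae_of_all _ fun z => ?_)
  have h1 : |inner ℝ u z * inner ℝ v z - inner ℝ u v| ≤
      1 / 2 * (inner ℝ u z ^ 2 + inner ℝ v z ^ 2) + 1 := by
    have h2 := abs_real_inner_le_norm u v
    rw [hu, hv, mul_one, abs_le] at h2
    rw [abs_le]
    constructor <;>
      nlinarith [sq_nonneg (inner ℝ u z - inner ℝ v z), sq_nonneg (inner ℝ u z + inner ℝ v z)]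
  calc ‖z‖ ^ p * |inner ℝ u z * inner ℝ v z - inner ℝ u v|
      ≤ ‖z‖ ^ p * (1 / 2 * (inner ℝ u z ^ 2 + inner ℝ v z ^ 2) + 1) := by gcongr
    _ = _ := by ring

end HolderAverages

section UnitInterval

lemma setIntegral_Ioo_one_sub {F : Type*} [NormedAddCommGroup F] [NormedSpace ℝ F] (g : ℝ → F) :
    ∫ t in Ioo (0 : ℝ) 1, g (1 - t) = ∫ t in Ioo (0 : ℝ) 1, g t := by
  rw [← integral_Ioc_eq_integral_Ioo, ← integral_Ioc_eq_integral_Ioo,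
    ← intervalIntegral.integral_of_le zero_le_one, ← intervalIntegral.integral_of_le zero_le_one,
    intervalIntegral.integral_comp_sub_left]
  simp

lemma integrableOn_Ioo_rpow {r : ℝ} (hr : -1 < r) :
    IntegrableOn (fun t : ℝ => t ^ r) (Ioo 0 1) :=
  (intervalIntegral.integrableOn_Ioo_rpow_iff zero_lt_one).2 hr

lemma integrableOn_Ioo_one_sub_rpow {r : ℝ} (hr : -1 < r) :
    IntegrableOn (fun t : ℝ => (1 - t) ^ r) (Ioo 0 1) := by
  have h := (intervalIntegral.intervalIntegrable_rpow' (a := 0) (b := 1) hr).comp_sub_left 1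
  rw [sub_zero, sub_self] at h
  exact (intervalIntegrable_iff_integrableOn_Ioo_of_le zero_le_one).1 h.symm

lemma setIntegral_Ioo_rpow {ρ r : ℝ} (hρ : 0 ≤ ρ) (hr : 0 < r) :
    ∫ t in Ioo (0 : ℝ) ρ, t ^ (r - 1) = ρ ^ r / r := by
  rw [← integral_Ioc_eq_integral_Ioo, ← intervalIntegral.integral_of_le hρ,
    integral_rpow (Or.inl (by linarith)), sub_add_cancel, Real.zero_rpow hr.ne', sub_zero]

/-- Interpolation between a singularity `t ^ (α / 2 - 1)` and the bound `r ^ α / t`. -/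
lemma abs_setIntegral_Ioo_le_mul_rpow {g : ℝ → ℝ} {A D r α β : ℝ} (hA : 0 ≤ A) (hD : 0 ≤ D)
    (hr : 0 ≤ r) (hβ : β ∈ Ioo 0 α) (hg1 : ∀ t ∈ Ioo (0 : ℝ) 1, |g t| ≤ A * t ^ (α / 2 - 1))
    (hg2 : ∀ t ∈ Ioo (0 : ℝ) 1, |g t| ≤ D * r ^ α * t⁻¹) :
    |∫ t in Ioo (0 : ℝ) 1, g t| ≤ (A * (2 / α) + D * (2 / (α - β))) * r ^ β := by
  have hα : 0 < α := hβ.1.trans hβ.2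
  have hαβ : 0 < α - β := sub_pos.2 hβ.2
  set ρ := min 1 (r ^ 2) with hρ
  have hρ0 : 0 ≤ ρ := le_min zero_le_one (sq_nonneg r)
  have hsub : Ioo 0 ρ ⊆ Ioo (0 : ℝ) 1 := Ioo_subset_Ioo_right (min_le_left _ _)
  have hi1 : IntegrableOn ((Ioo 0 ρ).indicator fun t : ℝ => A * t ^ (α / 2 - 1)) (Ioo 0 1) :=
    ((integrableOn_Ioo_rpow (by linarith)).const_mul A).indicator measurableSet_Ioo
  have hi2 : IntegrableOn (fun t : ℝ => D * r ^ β * t ^ ((α - β) / 2 - 1)) (Ioo 0 1) :=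
    (integrableOn_Ioo_rpow (by linarith)).const_mul _
  have hbound : ∀ t ∈ Ioo (0 : ℝ) 1, ‖g t‖ ≤
      (Ioo 0 ρ).indicator (fun t : ℝ => A * t ^ (α / 2 - 1)) t +
        D * r ^ β * t ^ ((α - β) / 2 - 1) := by
    intro t ht
    rw [Real.norm_eq_abs]
    have h0 : 0 ≤ D * r ^ β * t ^ ((α - β) / 2 - 1) := by have := ht.1.le; positivity
    by_cases htρ : t < ρ
    · rw [indicator_of_mem (show t ∈ Ioo 0 ρ from ⟨ht.1, htρ⟩)]
      linarith [hg1 t ht]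
    · rw [indicator_of_notMem (fun h => htρ h.2), zero_add]
      have hrt : r ^ 2 ≤ t := by
        rcases min_le_iff.1 (not_lt.1 htρ) with h | h
        · exact absurd ht.2 (not_lt.2 h)
        · exact h
      refine (hg2 t ht).trans ?_
      have h1 : r ^ α = r ^ β * r ^ (α - β) := by
        rw [← Real.rpow_add_of_nonneg hr hβ.1.le hαβ.le, add_sub_cancel]
      have h2 : r ^ (α - β) ≤ t ^ ((α - β) / 2) := by
        calc r ^ (α - β) = (r ^ 2) ^ ((α - β) / 2) := by
              rw [← Real.rpow_natCast, ← Real.rpow_mul hr]; congr 1; push_cast; ring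
          _ ≤ _ := Real.rpow_le_rpow (sq_nonneg r) hrt (by linarith)
      rw [Real.rpow_sub_one ht.1.ne', h1, div_eq_mul_inv, ← mul_assoc, ← mul_assoc]
      have := ht.1.le
      gcongr
  have hle := norm_integral_le_of_norm_le (hi1.add hi2)
    ((ae_restrict_iff' measurableSet_Ioo).2 (ae_of_all _ hbound))
  rw [Real.norm_eq_abs] at hle
  refine hle.trans ?_
  have e1 : ∫ t in Ioo (0 : ℝ) 1, (Ioo 0 ρ).indicator (fun t : ℝ => A * t ^ (α / 2 - 1)) t =
      A * (ρ ^ (α / 2) / (α / 2)) := by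
    rw [setIntegral_indicator measurableSet_Ioo, inter_eq_self_of_subset_right hsub,
      integral_const_mul, setIntegral_Ioo_rpow hρ0 (by linarith)]
  have e2 : ∫ t in Ioo (0 : ℝ) 1, D * r ^ β * t ^ ((α - β) / 2 - 1) =
      D * r ^ β * (2 / (α - β)) := by
    rw [integral_const_mul, setIntegral_Ioo_rpow zero_le_one (by linarith), Real.one_rpow,
      one_div_div]
  have e3 : ρ ^ (α / 2) ≤ r ^ β := by
    rcases hρ0.eq_or_lt with h | h
    · rw [← h, Real.zero_rpow (by linarith)]; positivity
    · calc ρ ^ (α / 2) ≤ ρ ^ (β / 2) :=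
            Real.rpow_le_rpow_of_exponent_ge h (min_le_left _ _) (by linarith [hβ.2])
        _ ≤ (r ^ 2) ^ (β / 2) := Real.rpow_le_rpow hρ0 (min_le_right _ _) (by linarith [hβ.1])
        _ = r ^ β := by rw [← Real.rpow_natCast, ← Real.rpow_mul hr]; congr 1; push_cast; ring
  have e4 : A * (ρ ^ (α / 2) / (α / 2)) ≤ A * (2 / α) * r ^ β := by
    rw [show ρ ^ (α / 2) / (α / 2) = 2 / α * ρ ^ (α / 2) by field_simp, mul_assoc]
    gcongr
  calc ∫ t in Ioo (0 : ℝ) 1, ((Ioo 0 ρ).indicator (fun t : ℝ => A * t ^ (α / 2 - 1)) t +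
        D * r ^ β * t ^ ((α - β) / 2 - 1))
      = A * (ρ ^ (α / 2) / (α / 2)) + D * r ^ β * (2 / (α - β)) := by
        rw [integral_add hi1 hi2, e1, e2]
    _ ≤ _ := by linarith

lemma one_div_sqrt_mul_sqrt_le {t : ℝ} (ht : t ∈ Ioo (0 : ℝ) 1) :
    1 / (√t * √(1 - t)) ≤ t ^ (-(1 / 2) : ℝ) + (1 - t) ^ (-(1 / 2) : ℝ) := by
  have h0 : 0 < √t := Real.sqrt_pos.2 ht.1
  have h1 : 0 < √(1 - t) := Real.sqrt_pos.2 (sub_pos.2 ht.2)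
  rw [Real.rpow_neg ht.1.le, Real.rpow_neg (sub_pos.2 ht.2).le, ← Real.sqrt_eq_rpow,
    ← Real.sqrt_eq_rpow, ← one_div, ← one_div, div_add_div _ _ h0.ne' h1.ne']
  gcongr
  linarith [one_sub_sqrt_one_sub_le ht]

lemma sqrt_rpow {t : ℝ} (ht : 0 ≤ t) (α : ℝ) : √t ^ α = t ^ (α / 2) := by
  rw [Real.sqrt_eq_rpow, ← Real.rpow_mul ht]; ring_nf

end UnitInterval

section SteinKernels

variable {E : Type*} [NormedAddCommGroup E] [InnerProductSpace ℝ E] [FiniteDimensional ℝ E]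
  [MeasurableSpace E] [BorelSpace E]

/-- The integrand, in the time variable, of Barbour's solution of the Stein equation. -/
noncomputable def steinKernel (h : E → ℝ) (t : ℝ) (x : E) : ℝ :=
  (1 / (2 * t)) * (∫ z, h (√t • x + √(1 - t) • z) ∂(ProbabilityTheory.stdGaussian E) -
    ∫ z, h z ∂(ProbabilityTheory.stdGaussian E))

/-- The spatial derivative of `steinKernel`. -/
noncomputable def steinKernelGrad (h : E → ℝ) (t : ℝ) (x : E) : E →L[ℝ] ℝ :=
  (1 / (2 * (√t * √(1 - t)))) •
    ∫ z, h (√t • x + √(1 - t) • z) • innerSL ℝ z ∂(ProbabilityTheory.stdGaussian E)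

/-- The spatial derivative of `steinKernelGrad` paired with `u`. -/
noncomputable def steinKernelHess (h : E → ℝ) (u : E) (t : ℝ) (x : E) : E →L[ℝ] ℝ :=
  (1 / (2 * (1 - t))) • ∫ z, h (√t • x + √(1 - t) • z) •
    (inner ℝ u z • innerSL ℝ z - innerSL ℝ u) ∂(ProbabilityTheory.stdGaussian E)

variable {h : E → ℝ} {α C : ℝ}

lemma stronglyMeasurable_integral_comp_sqrt_smul {F : Type*} [NormedAddCommGroup F]
    [NormedSpace ℝ F] {R : E → F} (hh : Continuous h) (hR : Continuous R) (x : E) :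
    StronglyMeasurable fun t : ℝ =>
      ∫ z, h (√t • x + √(1 - t) • z) • R z ∂(ProbabilityTheory.stdGaussian E) := by
  have hc : Continuous fun p : ℝ × E => h (√p.1 • x + √(1 - p.1) • p.2) • R p.2 := by fun_prop
  exact hc.stronglyMeasurable.integral_prod_right'

lemma hasFDerivAt_steinKernel (hα : α ∈ Ioc (0 : ℝ) 1) (hC0 : 0 ≤ C)
    (hC : ∀ x y, |h x - h y| ≤ C * ‖x - y‖ ^ α) {t : ℝ} (ht : t ∈ Ioo (0 : ℝ) 1) (x : E) :
    HasFDerivAt (steinKernel h t) (steinKernelGrad h t x) x := by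
  have h0 : 0 < √t := Real.sqrt_pos.2 ht.1
  have h1 : 0 < √(1 - t) := Real.sqrt_pos.2 (sub_pos.2 ht.2)
  have key := ((hasFDerivAt_integral_stdGaussian (continuous_of_abs_sub_le_rpow hα.1 hC)
    (abs_le_of_abs_sub_le_rpow hα hC0 hC) (√t) h1 x).sub_const
      (∫ z, h z ∂(ProbabilityTheory.stdGaussian E))).const_mul (1 / (2 * t))
  refine key.congr_fderiv ?_
  rw [steinKernelGrad, smul_smul]
  congr 1
  nth_rw 1 [← Real.sq_sqrt ht.1.le]
  field_simp

lemma steinKernelGrad_apply (hα : α ∈ Ioc (0 : ℝ) 1) (hC0 : 0 ≤ C)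
    (hC : ∀ x y, |h x - h y| ≤ C * ‖x - y‖ ^ α) (u : E) (t : ℝ) (x : E) :
    steinKernelGrad h t x u = (1 / (2 * (√t * √(1 - t)))) *
      ∫ z, h (√t • x + √(1 - t) • z) * inner ℝ u z ∂(ProbabilityTheory.stdGaussian E) := by
  rw [steinKernelGrad, _root_.smul_apply,
    ContinuousLinearMap.integral_apply (integrable_comp_affine_smul_stdGaussian hα hC0 hC
      (by fun_prop) norm_innerSL_le_one_add_sq _ _ x)]
  simp [real_inner_comm]

lemma steinKernelHess_apply (hα : α ∈ Ioc (0 : ℝ) 1) (hC0 : 0 ≤ C)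
    (hC : ∀ x y, |h x - h y| ≤ C * ‖x - y‖ ^ α) (u v : E) (t : ℝ) (x : E) :
    steinKernelHess h u t x v = (1 / (2 * (1 - t))) *
      ∫ z, h (√t • x + √(1 - t) • z) • (inner ℝ u z * inner ℝ v z - inner ℝ u v)
        ∂(ProbabilityTheory.stdGaussian E) := by
  rw [steinKernelHess, _root_.smul_apply,
    ContinuousLinearMap.integral_apply (integrable_comp_affine_smul_stdGaussian hα hC0 hC
      (by fun_prop) (norm_inner_smul_innerSL_sub_le u) _ _ x)]
  simp [real_inner_comm]

lemma hasFDerivAt_steinKernelGrad_apply (hα : α ∈ Ioc (0 : ℝ) 1) (hC0 : 0 ≤ C)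
    (hC : ∀ x y, |h x - h y| ≤ C * ‖x - y‖ ^ α) (u : E) {t : ℝ} (ht : t ∈ Ioo (0 : ℝ) 1)
    (x : E) :
    HasFDerivAt (fun x => steinKernelGrad h t x u) (steinKernelHess h u t x) x := by
  have h0 : 0 < √t := Real.sqrt_pos.2 ht.1
  have h1 : 0 < √(1 - t) := Real.sqrt_pos.2 (sub_pos.2 ht.2)
  simp_rw [steinKernelGrad_apply hα hC0 hC]
  refine ((hasFDerivAt_integral_mul_inner_stdGaussian (continuous_of_abs_sub_le_rpow hα.1 hC)
    (abs_le_of_abs_sub_le_rpow hα hC0 hC) u (√t) h1 x).const_mul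
      (1 / (2 * (√t * √(1 - t))))).congr_fderiv ?_
  rw [steinKernelHess, smul_smul]
  congr 1
  nth_rw 3 [← Real.sq_sqrt (sub_pos.2 ht.2).le]
  field_simp

lemma integrable_steinKernel (hα : α ∈ Ioc (0 : ℝ) 1) (hC0 : 0 ≤ C)
    (hC : ∀ x y, |h x - h y| ≤ C * ‖x - y‖ ^ α) (x : E) :
    IntegrableOn (fun t => steinKernel h t x) (Ioo 0 1) := by
  set M := ∫ z, (‖x‖ + ‖z‖) ^ α ∂(ProbabilityTheory.stdGaussian E)
  refine ((integrableOn_Ioo_rpow (r := α / 2 - 1) (by linarith [hα.1])).const_mul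
    (C * M / 2)).mono' ?_ ((ae_restrict_iff' measurableSet_Ioo).2 (ae_of_all _ fun t ht => ?_))
  · have h1 := stronglyMeasurable_integral_comp_sqrt_smul (R := fun _ => (1 : ℝ))
      (continuous_of_abs_sub_le_rpow hα.1 hC) continuous_const x
    simp only [smul_eq_mul, mul_one] at h1
    exact ((by fun_prop : Measurable fun t : ℝ => 1 / (2 * t)).stronglyMeasurable.mul
      (h1.sub stronglyMeasurable_const)).aestronglyMeasurable
  · have h2 := abs_integral_comp_affine_sub_le hα hC0 hC ht x
    have h3 : 0 < 1 / (2 * t) := by have := ht.1; positivity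
    rw [steinKernel, Real.norm_eq_abs, abs_mul, abs_of_pos h3, Real.rpow_sub_one ht.1.ne']
    refine (mul_le_mul_of_nonneg_left h2 h3.le).trans_eq ?_
    have := ht.1.ne'
    field_simp
    rfl

lemma aestronglyMeasurable_steinKernelGrad (hα : α ∈ Ioc (0 : ℝ) 1)
    (hC : ∀ x y, |h x - h y| ≤ C * ‖x - y‖ ^ α) (x : E) (μ : Measure ℝ) :
    AEStronglyMeasurable (fun t => steinKernelGrad h t x) μ :=
  ((by fun_prop : Measurable fun t : ℝ => 1 / (2 * (√t * √(1 - t)))).stronglyMeasurable.smul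
    (stronglyMeasurable_integral_comp_sqrt_smul (continuous_of_abs_sub_le_rpow hα.1 hC)
      (by fun_prop) x)).aestronglyMeasurable

lemma aestronglyMeasurable_steinKernelHess (hα : α ∈ Ioc (0 : ℝ) 1)
    (hC : ∀ x y, |h x - h y| ≤ C * ‖x - y‖ ^ α) (u x : E) (μ : Measure ℝ) :
    AEStronglyMeasurable (fun t => steinKernelHess h u t x) μ :=
  ((by fun_prop : Measurable fun t : ℝ => 1 / (2 * (1 - t))).stronglyMeasurable.smul
    (stronglyMeasurable_integral_comp_sqrt_smul (continuous_of_abs_sub_le_rpow hα.1 hC)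
      (by fun_prop) x)).aestronglyMeasurable

lemma exists_bound_steinKernelGrad (hα : α ∈ Ioc (0 : ℝ) 1) (hC0 : 0 ≤ C)
    (hC : ∀ x y, |h x - h y| ≤ C * ‖x - y‖ ^ α) :
    ∃ b : ℝ → ℝ, IntegrableOn b (Ioo 0 1) ∧
      ∀ t ∈ Ioo (0 : ℝ) 1, ∀ x, ‖steinKernelGrad h t x‖ ≤ b t := by
  set M := ∫ z : E, ‖z‖ ^ α * ‖innerSL ℝ z‖ ∂(ProbabilityTheory.stdGaussian E)
  have hM : 0 ≤ M := integral_nonneg fun z => by positivity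
  refine ⟨fun t => C * M / 2 * (t ^ (-(1 / 2) : ℝ) + (1 - t) ^ (-(1 / 2) : ℝ)),
    ((integrableOn_Ioo_rpow (by norm_num)).add
      (integrableOn_Ioo_one_sub_rpow (by norm_num))).const_mul _, fun t ht x => ?_⟩
  have h0 : 0 < √t := Real.sqrt_pos.2 ht.1
  have h1 : 0 < √(1 - t) := Real.sqrt_pos.2 (sub_pos.2 ht.2)
  have h2 := norm_integral_comp_affine_smul_le hα hC0 hC (by fun_prop)
    norm_innerSL_le_one_add_sq integral_innerSL_stdGaussian (√t) h1.le x
  have h3 : √(1 - t) ^ α ≤ 1 :=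
    Real.rpow_le_one h1.le (Real.sqrt_le_one.2 (by linarith [ht.1])) hα.1.le
  rw [steinKernelGrad, norm_smul, norm_of_nonneg (by positivity)]
  calc _ ≤ 1 / (2 * (√t * √(1 - t))) * (C * 1 * M) := by
        gcongr
        exact h2.trans (by gcongr)
    _ = C * M / 2 * (1 / (√t * √(1 - t))) := by field_simp
    _ ≤ _ := mul_le_mul_of_nonneg_left (one_div_sqrt_mul_sqrt_le ht) (by positivity)

lemma exists_bound_steinKernelHess (hα : α ∈ Ioc (0 : ℝ) 1) (hC0 : 0 ≤ C)
    (hC : ∀ x y, |h x - h y| ≤ C * ‖x - y‖ ^ α) (u : E) :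
    ∃ b : ℝ → ℝ, IntegrableOn b (Ioo 0 1) ∧
      ∀ t ∈ Ioo (0 : ℝ) 1, ∀ x, ‖steinKernelHess h u t x‖ ≤ b t := by
  set M := ∫ z : E, ‖z‖ ^ α * ‖inner ℝ u z • innerSL ℝ z - innerSL ℝ u‖
    ∂(ProbabilityTheory.stdGaussian E)
  refine ⟨fun t => C * M / 2 * (1 - t) ^ (α / 2 - 1),
    (integrableOn_Ioo_one_sub_rpow (by linarith [hα.1])).const_mul _, fun t ht x => ?_⟩
  have ht' : 0 < 1 - t := sub_pos.2 ht.2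
  have h2 := norm_integral_comp_affine_smul_le hα hC0 hC (by fun_prop)
    (norm_inner_smul_innerSL_sub_le u) (integral_inner_smul_innerSL_sub_stdGaussian u) (√t)
    (Real.sqrt_nonneg (1 - t)) x
  rw [sqrt_rpow ht'.le] at h2
  beta_reduce
  rw [steinKernelHess, norm_smul, norm_of_nonneg (by positivity), Real.rpow_sub_one ht'.ne']
  refine (mul_le_mul_of_nonneg_left h2 (by positivity)).trans_eq ?_
  field_simp
  rfl

lemma integrable_steinKernelGrad (hα : α ∈ Ioc (0 : ℝ) 1) (hC0 : 0 ≤ C)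
    (hC : ∀ x y, |h x - h y| ≤ C * ‖x - y‖ ^ α) (x : E) :
    IntegrableOn (fun t => steinKernelGrad h t x) (Ioo 0 1) := by
  obtain ⟨b, hb, hle⟩ := exists_bound_steinKernelGrad hα hC0 hC
  exact hb.mono' (aestronglyMeasurable_steinKernelGrad hα hC x _)
    ((ae_restrict_iff' measurableSet_Ioo).2 (ae_of_all _ fun t ht => hle t ht x))

lemma integrable_steinKernelHess (hα : α ∈ Ioc (0 : ℝ) 1) (hC0 : 0 ≤ C)
    (hC : ∀ x y, |h x - h y| ≤ C * ‖x - y‖ ^ α) (u x : E) :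
    IntegrableOn (fun t => steinKernelHess h u t x) (Ioo 0 1) := by
  obtain ⟨b, hb, hle⟩ := exists_bound_steinKernelHess hα hC0 hC u
  exact hb.mono' (aestronglyMeasurable_steinKernelHess hα hC u x _)
    ((ae_restrict_iff' measurableSet_Ioo).2 (ae_of_all _ fun t ht => hle t ht x))

lemma hasFDerivAt_setIntegral_steinKernel (hα : α ∈ Ioc (0 : ℝ) 1) (hC0 : 0 ≤ C)
    (hC : ∀ x y, |h x - h y| ≤ C * ‖x - y‖ ^ α) (x : E) :
    HasFDerivAt (fun x => ∫ t in Ioo (0 : ℝ) 1, steinKernel h t x)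
      (∫ t in Ioo (0 : ℝ) 1, steinKernelGrad h t x) x := by
  obtain ⟨b, hb, hle⟩ := exists_bound_steinKernelGrad hα hC0 hC
  exact hasFDerivAt_integral_of_dominated_of_fderiv_le (s := univ) (bound := b)
    (F := fun x t => steinKernel h t x) (F' := fun x t => steinKernelGrad h t x) univ_mem
    (Eventually.of_forall fun y => (integrable_steinKernel hα hC0 hC y).aestronglyMeasurable)
    (integrable_steinKernel hα hC0 hC x) (aestronglyMeasurable_steinKernelGrad hα hC x _)
    ((ae_restrict_iff' measurableSet_Ioo).2 (ae_of_all _ fun t ht y _ => hle t ht y)) hb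
    ((ae_restrict_iff' measurableSet_Ioo).2
      (ae_of_all _ fun t ht y _ => hasFDerivAt_steinKernel hα hC0 hC ht y))

lemma hasFDerivAt_setIntegral_steinKernelGrad_apply (hα : α ∈ Ioc (0 : ℝ) 1) (hC0 : 0 ≤ C)
    (hC : ∀ x y, |h x - h y| ≤ C * ‖x - y‖ ^ α) (u x : E) :
    HasFDerivAt (fun x => (∫ t in Ioo (0 : ℝ) 1, steinKernelGrad h t x) u)
      (∫ t in Ioo (0 : ℝ) 1, steinKernelHess h u t x) x := by
  obtain ⟨b, hb, hle⟩ := exists_bound_steinKernelHess hα hC0 hC u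
  have e : (fun x => (∫ t in Ioo (0 : ℝ) 1, steinKernelGrad h t x) u) =
      fun x => ∫ t in Ioo (0 : ℝ) 1, steinKernelGrad h t x u :=
    funext fun y => ContinuousLinearMap.integral_apply (integrable_steinKernelGrad hα hC0 hC y) u
  have hi : ∀ y, IntegrableOn (fun t => steinKernelGrad h t y u) (Ioo 0 1) := fun y =>
    (integrable_steinKernelGrad hα hC0 hC y).apply_continuousLinearMap u
  rw [e]
  exact hasFDerivAt_integral_of_dominated_of_fderiv_le (s := univ) (bound := b)
    (F := fun x t => steinKernelGrad h t x u) (F' := fun x t => steinKernelHess h u t x) univ_mem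
    (Eventually.of_forall fun y => (hi y).aestronglyMeasurable)
    (hi x) (aestronglyMeasurable_steinKernelHess hα hC u x _)
    ((ae_restrict_iff' measurableSet_Ioo).2 (ae_of_all _ fun t ht y _ => hle t ht y)) hb
    ((ae_restrict_iff' measurableSet_Ioo).2
      (ae_of_all _ fun t ht y _ => hasFDerivAt_steinKernelGrad_apply hα hC0 hC u ht y))

/-- The integrated Hessian kernel is `β`-Hölder for every `β < α`. -/
lemma norm_setIntegral_steinKernelHess_sub_le [Nontrivial E] (hα : α ∈ Ioc (0 : ℝ) 1)
    (hC0 : 0 ≤ C) (hC : ∀ x y, |h x - h y| ≤ C * ‖x - y‖ ^ α) {β : ℝ} (hβ : β ∈ Ioo 0 α)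
    {u : E} (hu : ‖u‖ = 1) (x y : E) :
    ‖(∫ t in Ioo (0 : ℝ) 1, steinKernelHess h u t x) -
        ∫ t in Ioo (0 : ℝ) 1, steinKernelHess h u t y‖ ≤
      (C * ((2 + α / Module.finrank ℝ E) * ∫ z : E, ‖z‖ ^ α ∂(ProbabilityTheory.stdGaussian E)) *
        (2 / α) + C * (2 / (α - β))) * ‖x - y‖ ^ β := by
  have hα0 := hα.1
  have hαβ : 0 < α - β := sub_pos.2 hβ.2
  set M := (2 + α / Module.finrank ℝ E) *
    ∫ z : E, ‖z‖ ^ α ∂(ProbabilityTheory.stdGaussian E)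
  have hM : 0 ≤ M := mul_nonneg (by positivity) (integral_nonneg fun z => by positivity)
  refine ContinuousLinearMap.opNorm_le_of_unit_norm (by positivity) fun v hv => ?_
  have hix := integrable_steinKernelHess hα hC0 hC u x
  have hiy := integrable_steinKernelHess hα hC0 hC u y
  have hi : IntegrableOn (fun t => steinKernelHess h u t x - steinKernelHess h u t y) (Ioo 0 1) :=
    hix.sub hiy
  rw [← integral_sub hix hiy, ContinuousLinearMap.integral_apply hi,
    ← setIntegral_Ioo_one_sub, Real.norm_eq_abs]
  have hR : Continuous fun z => inner ℝ u z * inner ℝ v z - inner ℝ u v := by fun_prop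
  have hRb := abs_inner_mul_inner_sub_le u v
  have hR1 : ∫ z : E, ‖inner ℝ u z * inner ℝ v z - inner ℝ u v‖
      ∂(ProbabilityTheory.stdGaussian E) ≤ 2 := by
    simpa using integral_norm_rpow_mul_abs_inner_mul_inner_sub_le hu hv le_rfl
  refine abs_setIntegral_Ioo_le_mul_rpow (by positivity) hC0 (norm_nonneg _) hβ
    (fun s hs => ?_) fun s hs => ?_
  all_goals
    have hs0 := hs.1
    rw [_root_.sub_apply, steinKernelHess_apply hα hC0 hC,
      steinKernelHess_apply hα hC0 hC, ← mul_sub, sub_sub_cancel, abs_mul,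
      abs_of_pos (by positivity : 0 < 1 / (2 * s)), ← Real.norm_eq_abs]
  · have hb : ∀ w : E, ‖∫ z, h (√(1 - s) • w + √s • z) •
        (inner ℝ u z * inner ℝ v z - inner ℝ u v) ∂(ProbabilityTheory.stdGaussian E)‖ ≤
        C * s ^ (α / 2) * M := fun w => by
      rw [← sqrt_rpow hs0.le]
      refine (norm_integral_comp_affine_smul_le hα hC0 hC hR hRb
        (integral_inner_mul_inner_sub_stdGaussian u v) _ (Real.sqrt_nonneg s) w).trans ?_
      gcongr
      exact integral_norm_rpow_mul_abs_inner_mul_inner_sub_le hu hv hα0.le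
    calc _ ≤ 1 / (2 * s) * (C * s ^ (α / 2) * M + C * s ^ (α / 2) * M) := by
          gcongr
          exact (norm_sub_le _ _).trans (add_le_add (hb x) (hb y))
      _ = _ := by rw [Real.rpow_sub_one hs0.ne']; field_simp; ring
  · have h1 : √(1 - s) ^ α ≤ 1 := Real.rpow_le_one (Real.sqrt_nonneg _)
      (Real.sqrt_le_one.2 (by linarith)) hα0.le
    calc _ ≤ 1 / (2 * s) * (C * 1 * ‖x - y‖ ^ α * 2) := by
          gcongr
          refine (norm_integral_comp_affine_smul_sub_le hα hC0 hC hR hRb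
            (Real.sqrt_nonneg (1 - s)) _ x y).trans ?_
          gcongr
      _ = _ := by field_simp

end SteinKernels

section EuclideanHessian

variable {d : ℕ}

lemma stdGaussian_eq_stdGaussian (d : ℕ) :
    _root_.stdGaussian d = ProbabilityTheory.stdGaussian (EuclideanSpace ℝ (Fin d)) :=
  map_pi_eq_stdGaussian

variable {h : EuclideanSpace ℝ (Fin d) → ℝ} {α C : ℝ}

lemma steinSol_eq_neg_setIntegral_steinKernel (hα : α ∈ Ioc (0 : ℝ) 1) (hC0 : 0 ≤ C)
    (hC : ∀ x y, |h x - h y| ≤ C * ‖x - y‖ ^ α) :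
    steinSol d h = fun x => -∫ t in Ioo (0 : ℝ) 1, steinKernel h t x := by
  funext x
  unfold steinSol steinKernel hbar
  rw [stdGaussian_eq_stdGaussian]
  congr 2
  funext t
  rw [integral_sub (integrable_comp_affine_stdGaussian hα hC0 hC _ _ x) (integrable_const _),
    integral_const]
  simp

lemma fderiv_steinSol (hα : α ∈ Ioc (0 : ℝ) 1) (hC0 : 0 ≤ C)
    (hC : ∀ x y, |h x - h y| ≤ C * ‖x - y‖ ^ α) (x : EuclideanSpace ℝ (Fin d)) :
    fderiv ℝ (steinSol d h) x = -∫ t in Ioo (0 : ℝ) 1, steinKernelGrad h t x := by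
  rw [steinSol_eq_neg_setIntegral_steinKernel hα hC0 hC]
  exact (hasFDerivAt_setIntegral_steinKernel hα hC0 hC x).neg.fderiv

lemma hasFDerivAt_fderiv_steinSol_apply (hα : α ∈ Ioc (0 : ℝ) 1) (hC0 : 0 ≤ C)
    (hC : ∀ x y, |h x - h y| ≤ C * ‖x - y‖ ^ α) (u x : EuclideanSpace ℝ (Fin d)) :
    HasFDerivAt (fun x => fderiv ℝ (steinSol d h) x u)
      (-∫ t in Ioo (0 : ℝ) 1, steinKernelHess h u t x) x := by
  simp_rw [fderiv_steinSol hα hC0 hC]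
  exact (hasFDerivAt_setIntegral_steinKernelGrad_apply hα hC0 hC u x).neg

lemma hessMatrix_steinSol_mulVec (hα : α ∈ Ioc (0 : ℝ) 1) (hC0 : 0 ≤ C)
    (hC : ∀ x y, |h x - h y| ≤ C * ‖x - y‖ ^ α) (v x : EuclideanSpace ℝ (Fin d)) (i : Fin d) :
    (hessMatrix (steinSol d h) x).mulVec (WithLp.equiv 2 (Fin d → ℝ) v) i =
      (-∫ t in Ioo (0 : ℝ) 1, steinKernelHess h v t x) (EuclideanSpace.single i 1) := by
  have h1 := HasFDerivAt.fun_sum (u := Finset.univ) fun j (_ : j ∈ Finset.univ) =>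
    (hasFDerivAt_fderiv_steinSol_apply hα hC0 hC (EuclideanSpace.single j 1) x).const_mul (v j)
  have hv : ∑ j, v j • EuclideanSpace.single j (1 : ℝ) = v := by
    ext k
    simp [Finset.sum_apply, Pi.single_apply]
  have h2 : (fun y => ∑ j, v j * fderiv ℝ (steinSol d h) y (EuclideanSpace.single j 1)) =
      fun y => fderiv ℝ (steinSol d h) y v := by
    funext y
    conv_rhs => rw [← hv, map_sum]
    simp
  rw [h2] at h1
  rw [(hasFDerivAt_fderiv_steinSol_apply hα hC0 hC v x).unique h1]
  have h3 : ∀ j, fderiv ℝ (pderivI j (steinSol d h)) x =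
      -∫ t in Ioo (0 : ℝ) 1, steinKernelHess h (EuclideanSpace.single j 1) t x := fun j =>
    (hasFDerivAt_fderiv_steinSol_apply hα hC0 hC _ x).fderiv
  simp only [Matrix.mulVec, dotProduct, hessMatrix, Matrix.of_apply, hessEntry, pderivI.eq_1 i, h3]
  simp [mul_comm]

lemma norm_symm_le_norm_of_apply_single (w : Fin d → ℝ) (L : EuclideanSpace ℝ (Fin d) →L[ℝ] ℝ)
    (hw : ∀ i, w i = L (EuclideanSpace.single i 1)) :
    ‖(WithLp.equiv 2 (Fin d → ℝ)).symm w‖ ≤ ‖L‖ := by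
  set W := (WithLp.equiv 2 (Fin d → ℝ)).symm w
  have hL : innerSL ℝ W = L := by
    refine ContinuousLinearMap.coe_injective ((EuclideanSpace.basisFun (Fin d) ℝ).toBasis.ext
      fun i => ?_)
    simp [← hw, W, EuclideanSpace.inner_single_right]
  rw [← hL, innerSL_apply_norm]

lemma C1_eq (hd : 1 ≤ d) (hα : 0 < α) :
    C1 α d = (2 + α / Module.finrank ℝ (EuclideanSpace ℝ (Fin d))) *
      (∫ z : EuclideanSpace ℝ (Fin d), ‖z‖ ^ α
        ∂(ProbabilityTheory.stdGaussian (EuclideanSpace ℝ (Fin d)))) * (2 / α) := by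
  have : Nonempty (Fin d) := ⟨⟨0, hd⟩⟩
  have hd0 : (d : ℝ) ≠ 0 := by positivity
  rw [integral_norm_rpow_stdGaussian hα.le, finrank_euclideanSpace_fin, C1,
    Real.rpow_add_one (by norm_num)]
  field_simp
  ring

end EuclideanHessian

/-- **Proposition 2.2, display (2.11)**: the Hessian of Barbour's solution is globally
`β`-Hölder in operator norm, for every `0 < β < α`. -/
theorem steinSol_hessian_beta_holder
    {d : ℕ} (hd : 1 ≤ d) {α : ℝ} (hα : α ∈ Set.Ioc (0 : ℝ) 1)
    (h : EuclideanSpace ℝ (Fin d) → ℝ)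
    {C : ℝ} (hC0 : 0 ≤ C) (hC : HolderConst α C h) :
    ∀ β ∈ Set.Ioo (0 : ℝ) α, ∀ x y : EuclideanSpace ℝ (Fin d),
      matOpNorm (hessMatrix (steinSol d h) x - hessMatrix (steinSol d h) y) ≤
        (C1 α d + 2 / (α - β)) * dist x y ^ β * C := by
  intro β hβ x y
  have : Nonempty (Fin d) := ⟨⟨0, hd⟩⟩
  have hC' : ∀ x y, |h x - h y| ≤ C * ‖x - y‖ ^ α := fun x y => by
    simpa only [dist_eq_norm] using hC x y
  have key := fun v (hv : ‖v‖ = 1) =>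
    norm_setIntegral_steinKernelHess_sub_le hα hC0 hC' hβ (u := v) hv x y
  rw [mul_assoc C, ← C1_eq hd hα.1, ← mul_add, ← dist_eq_norm x y] at key
  obtain ⟨v₀, hv₀⟩ := exists_norm_eq (EuclideanSpace ℝ (Fin d)) zero_le_one
  refine csSup_le ⟨_, v₀, hv₀, rfl⟩ ?_
  rintro _ ⟨v, hv, rfl⟩
  refine (norm_symm_le_norm_of_apply_single _
    (-((∫ t in Ioo (0 : ℝ) 1, steinKernelHess h v t x) -
      ∫ t in Ioo (0 : ℝ) 1, steinKernelHess h v t y)) fun i => ?_).trans ?_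
  · rw [Matrix.sub_mulVec, Pi.sub_apply, hessMatrix_steinSol_mulVec hα hC0 hC',
      hessMatrix_steinSol_mulVec hα hC0 hC', ← _root_.sub_apply, neg_sub_neg, neg_sub]
  · rw [norm_neg]
    exact (key v hv).trans_eq (by ring)
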